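/- arXiv:1504.03946 — 6 statements merged into one kernel-verified Lean document; each statement's English description precedes it below -/
import Mathlib

section
/- Let q ≥ 1 and k ≥ 1 be integers, let N be a positive integer, and let B : Fin k → Finset (Fin N) be a family of 'constraint blocks' each of cardinality q, such that for every m with 1 ≤ m < k the intersection of B m with the union of B 0, …, B (m-1) has cardinality exactly 1 (i.e., the blocks are attached one at a time in tree fashion, each new block sharing exactly one variable with the previously built tree), and such that the union of all blocks is all of Fin N (so N = q + (k-1)(q-1)). Then the number of assignments x : Fin N → Fin q such that x is injective on every block B m equals q! · ((q-1)!)^(k-1). -/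
open Classical in
theorem aux_count {V α : Type*} [Fintype V] [Fintype α] (D : Finset V) (A : Finset α) (y : V → α) :
    (Finset.univ.filter (fun x : V → α => (∀ v, v ∉ D → x v = y v) ∧ Set.InjOn x D ∧
      ∀ v ∈ D, x v ∈ A)).card = A.card.descFactorial D.card := by
  have e : {x : V → α // (∀ v, v ∉ D → x v = y v) ∧ Set.InjOn x D ∧ ∀ v ∈ D, x v ∈ A} ≃
      (D ↪ A) :=
    { toFun := fun x => ⟨fun d => ⟨x.1 d.1, x.2.2.2 d.1 d.2⟩, by
        intro a b h
        exact Subtype.ext (x.2.2.1 a.2 b.2 (congrArg Subtype.val h))⟩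
      invFun := fun e => ⟨fun v => if h : v ∈ D then (e ⟨v, h⟩).1 else y v, by
        refine ⟨fun v hv => by simp [hv], ?_, fun v hv => by simp [hv]⟩
        intro a ha b hb h
        have ha' : a ∈ D := ha
        have hb' : b ∈ D := hb
        simp only [ha', hb', dite_true] at h
        exact congrArg Subtype.val (e.injective (Subtype.ext h))⟩
      left_inv := by
        intro x
        apply Subtype.ext
        funext v
        by_cases hv : v ∈ D
        · simp only [hv, dite_true]
          rfl
        · simp [hv, x.2.1 v hv]
      right_inv := by
        intro e
        ext d
        simp }
  rw [← Fintype.card_subtype, Fintype.card_congr e, Fintype.card_embedding_eq]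
  simp

open Classical in
theorem aux_step {V : Type*} [Fintype V] [DecidableEq V] (q : ℕ) (a0 : Fin q) (B : ℕ → Finset V) (n : ℕ)
    (hcard : ∀ m ≤ n, (B m).card = q)
    (htree : ∀ m ≤ n, 1 ≤ m → (B m ∩ (Finset.range m).biUnion B).card = 1) :
    (Finset.univ.filter (fun x : V → Fin q => (∀ m < n + 1, Set.InjOn x (B m)) ∧
      ∀ v, v ∉ (Finset.range (n + 1)).biUnion B → x v = a0)).card =
      Nat.factorial q * (Nat.factorial (q - 1)) ^ n := by
  induction n with
  | zero =>
    have := aux_count (B 0) (Finset.univ : Finset (Fin q)) (fun _ => a0)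
    rw [hcard 0 le_rfl, Finset.card_univ, Fintype.card_fin, Nat.descFactorial_self] at this
    rw [pow_zero, mul_one, ← this]
    congr 1
    ext x
    simp
    tauto
  | succ n ih =>
    have ih := ih (fun m hm => hcard m (by omega)) (fun m hm => htree m (by omega))
    have hC := hcard (n + 1) le_rfl
    have hc1 := htree (n + 1) le_rfl (by omega)
    set C := B (n + 1) with hCdef
    set U := (Finset.range (n + 1)).biUnion B with hU
    have hU' : (Finset.range (n + 1 + 1)).biUnion B = C ∪ U := by
      rw [Finset.range_add_one, Finset.biUnion_insert]
    rw [hU']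
    obtain ⟨c, hc⟩ := Finset.card_eq_one.1 hc1
    have hcm : ∀ v, (v ∈ C ∧ v ∈ U) ↔ v = c := by
      intro v
      rw [← Finset.mem_inter, hc, Finset.mem_singleton]
    have hcC := ((hcm c).2 rfl).1
    have hcU := ((hcm c).2 rfl).2
    have hBU : ∀ m < n + 1, ∀ v ∈ B m, v ∈ U := fun m hm v hv =>
      Finset.mem_biUnion.2 ⟨m, Finset.mem_range.2 hm, hv⟩
    have hDcard : (C \ U).card = q - 1 := by
      have := Finset.card_sdiff_add_card_inter C U
      omega
    rw [pow_succ, ← mul_assoc, ← ih]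
    rw [Finset.card_eq_sum_card_fiberwise (f := fun x v => if v ∈ U then x v else a0)
      (t := Finset.univ.filter (fun x : V → Fin q => (∀ m < n + 1, Set.InjOn x (B m)) ∧
      ∀ v, v ∉ U → x v = a0)), Finset.sum_const_nat]
    · intro y hy
      simp only [Finset.mem_filter, Finset.mem_univ, true_and] at hy
      have := aux_count (C \ U) (Finset.univ.erase (y c)) y
      rw [hDcard, Finset.card_erase_of_mem (Finset.mem_univ _), Finset.card_univ, Fintype.card_fin,
        Nat.descFactorial_self] at this
      rw [← this]
      congr 1
      ext x
      simp only [Finset.mem_filter, Finset.mem_univ, true_and, Finset.mem_erase, and_true,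
        Finset.mem_sdiff, Finset.mem_union]
      constructor
      · rintro ⟨⟨h1, h2⟩, h3⟩
        have hxy : ∀ v ∈ U, x v = y v := by
          intro v hv
          have := congrFun h3 v
          simpa [hv] using this
        refine ⟨?_, ?_, ?_⟩
        · intro v hv
          by_cases hvU : v ∈ U
          · exact hxy v hvU
          · rw [hy.2 v hvU]
            exact h2 v (by tauto)
        · exact (h1 (n + 1) (by omega)).mono (by simp [hCdef])
        · rintro v ⟨hvC, hvU⟩ h
          rw [← hxy c hcU] at h
          have := h1 (n + 1) (by omega) hvC hcC h
          exact hvU (this ▸ hcU)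
      · rintro ⟨h1, h2, h3⟩
        have hxy : ∀ v ∈ U, x v = y v := fun v hv => h1 v (by tauto)
        refine ⟨⟨?_, ?_⟩, ?_⟩
        · intro m hm
          rcases Nat.lt_succ_iff_lt_or_eq.1 hm with hm | rfl
          · exact (hy.1 m hm).congr (fun v hv => (hxy v (hBU m hm v hv)).symm)
          · intro a ha b hb hab
            have ha : a ∈ C := ha
            have hb : b ∈ C := hb
            by_cases haU : a ∈ U <;> by_cases hbU : b ∈ U
            · rw [(hcm a).1 ⟨ha, haU⟩, (hcm b).1 ⟨hb, hbU⟩]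
            · have := (hcm a).1 ⟨ha, haU⟩
              subst this
              exact absurd (hab.symm.trans (hxy _ haU)) (h3 b ⟨hb, hbU⟩)
            · have := (hcm b).1 ⟨hb, hbU⟩
              subst this
              exact absurd (hab.trans (hxy _ hbU)) (h3 a ⟨ha, haU⟩)
            · exact h2 (by simp [ha, haU]) (by simp [hb, hbU]) hab
        · intro v hv
          rw [h1 v (by tauto), hy.2 v (by tauto)]
        · funext v
          by_cases hvU : v ∈ U
          · simp [hvU, hxy v hvU]
          · simp [hvU, hy.2 v hvU]
    · intro x hx
      simp only [Finset.coe_filter, Finset.mem_univ, true_and, Set.mem_ofPred_eq] at hx ⊢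
      refine ⟨fun m hm => ?_, fun v hv => by simp [hv]⟩
      exact (hx.1 m (by omega)).congr (fun v hv => by simp [hBU m hm v hv])

/-- Counting claim from the proof of Lemma 1: if `k` constraint blocks of size `q`
are attached in tree fashion (each block after the first shares exactly one
variable with the union of the previous blocks) and together cover all `N`
variables, then the number of assignments of values from an alphabet of size `q`
that are injective on every block is `q! ((q-1)!)^(k-1)`. -/
theorem tree_codeword_count (q k N : ℕ) (hq : 1 ≤ q) (hk : 1 ≤ k) (hN : 0 < N)
    (B : Fin k → Finset (Fin N))
    (hcard : ∀ m : Fin k, (B m).card = q)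
    (htree : ∀ m : Fin k, 1 ≤ m.val →
      ((B m) ∩ (Finset.Iio m).biUnion B).card = 1)
    (hcover : (Finset.univ : Finset (Fin k)).biUnion B = Finset.univ) :
    (Finset.univ.filter
        (fun x : Fin N → Fin q => ∀ m : Fin k, Set.InjOn x (B m))).card =
      Nat.factorial q * (Nat.factorial (q - 1)) ^ (k - 1) := by
  obtain ⟨n, rfl⟩ : ∃ n, k = n + 1 := ⟨k - 1, by omega⟩
  have key := aux_step q ⟨0, hq⟩ (fun m => if h : m < n + 1 then B ⟨m, h⟩ else ∅) n
    (fun m hm => by simp [Nat.lt_succ_of_le hm, hcard])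
    (fun m hm h1 => by
      have hm' : m < n + 1 := Nat.lt_succ_of_le hm
      refine Eq.trans ?_ (htree ⟨m, hm'⟩ h1)
      simp only [hm', dite_true]
      congr 2
      ext v
      simp only [Finset.mem_biUnion, Finset.mem_range, Finset.mem_Iio]
      constructor
      · rintro ⟨a, ha, hv⟩
        have ha' : a < n + 1 := by omega
        exact ⟨⟨a, ha'⟩, ha, by simpa [ha'] using hv⟩
      · rintro ⟨a, ha, hv⟩
        exact ⟨a.1, ha, by simpa only [a.2, dite_true] using hv⟩)
  rw [Nat.add_sub_cancel, ← key]
  congr 1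
  ext x
  simp only [Finset.mem_filter, Finset.mem_univ, true_and]
  constructor
  · intro h
    refine ⟨fun m hm => by simpa [hm] using h ⟨m, hm⟩, fun v hv => ?_⟩
    exfalso
    apply hv
    have : v ∈ (Finset.univ : Finset (Fin (n + 1))).biUnion B := by simp [hcover]
    obtain ⟨a, -, ha⟩ := Finset.mem_biUnion.1 this
    exact Finset.mem_biUnion.2 ⟨a.1, Finset.mem_range.2 a.2, by simpa only [a.2, dite_true] using ha⟩
  · rintro ⟨h, -⟩ m
    simpa only [m.2, dite_true] using h m.1 m.2
end

section
/- Let q ≥ 1, let A be a q×q matrix with entries in a commutative semiring, and fix indices i, j ∈ {1,…,q}. Then perm(A_{ij}) = ∑_S F(S) · G(S ∪ {j}), where the sum ranges over all subsets S of {1,…,q} with |S| = i−1 and j ∉ S; here F(S) denotes the sum over all bijections τ from rows {1,…,i−1} to the columns in S of ∏_{k<i} a_{k,τ(k)}, and G(T) denotes the sum over all bijections ρ from rows {i+1,…,q} to the columns in the complement of T of ∏_{k>i} a_{k,ρ(k)}. (This is the forward–backward / BCJR computation of the co-factor perm(A_{ij}) on the subset trellis.) -/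
/-- The permanent of an `n × n` matrix: `perm M = ∑_{σ ∈ S_n} ∏_i M i (σ i)`. -/
def permanent {n : ℕ} {R : Type*} [CommSemiring R] (M : Matrix (Fin n) (Fin n) R) : R :=
  ∑ σ : Equiv.Perm (Fin n), ∏ i, M i (σ i)

/-- Forward sum at trellis state `S`: the sum over all bijections `τ` from the
rows preceding `i` onto the column set `S` of `∏_{k < i} a_{k, τ k}`. -/
def forwardSum {n : ℕ} {R : Type*} [CommSemiring R]
    (A : Matrix (Fin (n + 1)) (Fin (n + 1)) R) (i : Fin (n + 1))
    (S : Finset (Fin (n + 1))) : R :=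
  ∑ τ ∈ Finset.univ.filter
      (fun τ : {k : Fin (n + 1) // k < i} → Fin (n + 1) =>
        Function.Injective τ ∧ Finset.univ.image τ = S),
    ∏ k : {k : Fin (n + 1) // k < i}, A k.val (τ k)

/-- Backward sum at trellis state `T`: the sum over all bijections `ρ` from the
rows following `i` onto the complement of the column set `T` of
`∏_{k > i} a_{k, ρ k}`. -/
def backwardSum {n : ℕ} {R : Type*} [CommSemiring R]
    (A : Matrix (Fin (n + 1)) (Fin (n + 1)) R) (i : Fin (n + 1))
    (T : Finset (Fin (n + 1))) : R :=
  ∑ ρ ∈ Finset.univ.filter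
      (fun ρ : {k : Fin (n + 1) // i < k} → Fin (n + 1) =>
        Function.Injective ρ ∧ Finset.univ.image ρ = Tᶜ),
    ∏ k : {k : Fin (n + 1) // i < k}, A k.val (ρ k)

theorem aux_prod {n : ℕ} {R : Type*} [CommSemiring R] (i : Fin (n + 1)) (h : Fin (n + 1) → R) :
    ∏ x, h (i.succAbove x) =
      (∏ k : {k : Fin (n + 1) // k < i}, h k) * ∏ k : {k : Fin (n + 1) // i < k}, h k := by
  have e1 : ∏ x, h (i.succAbove x) = ∏ k ∈ ({i}ᶜ : Finset (Fin (n + 1))), h k := by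
    rw [← Fin.image_succAbove_univ, Finset.prod_image]
    intro a _ b _ hab
    exact Fin.succAbove_right_injective hab
  rw [e1, ← Finset.prod_subtype (Finset.univ.filter (fun k => k < i)) (by simp) h,
    ← Finset.prod_subtype (Finset.univ.filter (fun k => i < k)) (by simp) h,
    ← Finset.prod_union]
  · congr 1
    ext k
    simp
  · rw [Finset.disjoint_left]
    intro a ha hb
    simp at ha hb
    exact absurd ha (not_lt.mpr hb.le)

theorem aux_inj {n : ℕ} (i j : Fin (n + 1)) (σ : Equiv.Perm (Fin n)) :
    Function.Injective
      (Fin.insertNth i j (fun x => j.succAbove (σ x)) : Fin (n + 1) → Fin (n + 1)) := by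
  intro a b
  rcases Fin.eq_self_or_eq_succAbove i a with ha | ⟨x, ha⟩ <;>
  rcases Fin.eq_self_or_eq_succAbove i b with hb | ⟨y, hb⟩
  · intro _; exact ha.trans hb.symm
  · rw [ha, hb]; simp
  · rw [ha, hb]; simp
  · rw [ha, hb]; simp

/-- Forward–backward (BCJR) computation of the co-factor `perm(A_{ij})` on the
subset trellis: `perm(A_{ij}) = ∑_{S : |S| = i - 1, j ∉ S} F(S) · G(S ∪ {j})`,
where `F` is the forward sum and `G` the backward sum, and rows/columns of the
`q × q` matrix `A` (`q = n + 1 ≥ 1`) are indexed so that `|S| = i - 1` in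
one-indexed terms is `S.card = i.val` in zero-indexed terms. -/
theorem permanent_minor_forward_backward {n : ℕ} {R : Type*} [CommSemiring R]
    (A : Matrix (Fin (n + 1)) (Fin (n + 1)) R) (i j : Fin (n + 1)) :
    permanent (A.submatrix i.succAbove j.succAbove) =
      ∑ S ∈ Finset.univ.filter
          (fun S : Finset (Fin (n + 1)) => S.card = i.val ∧ j ∉ S),
        forwardSum A i S * backwardSum A i (insert j S) := by
  unfold permanent forwardSum backwardSum
  simp_rw [Finset.sum_mul_sum, ← Finset.sum_product']
  rw [Finset.sum_sigma']
  let G : Equiv.Perm (Fin n) → Fin (n + 1) → Fin (n + 1) := fun σ =>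
    Fin.insertNth i j (fun x => j.succAbove (σ x))
  have Gi : ∀ σ, G σ i = j := fun σ => by simp [G]
  have Gs : ∀ σ x, G σ (i.succAbove x) = j.succAbove (σ x) := fun σ x => by simp [G]
  have Ginj : ∀ σ, Function.Injective (G σ) := fun σ => aux_inj i j σ
  have Gsurj : ∀ σ, Function.Surjective (G σ) := fun σ =>
    Finite.surjective_of_injective (Ginj σ)
  clear_value G
  refine Finset.sum_bij (fun σ _ => ⟨Finset.univ.image (fun k : {k // k < i} => G σ k),
    (fun k => G σ k, fun k => G σ k)⟩) ?_ ?_ ?_ ?_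
  · intro σ _
    have i1 : Function.Injective (fun k : {k // k < i} => G σ k) :=
      (Ginj σ).comp Subtype.val_injective
    have i2 : Function.Injective (fun k : {k // i < k} => G σ k) :=
      (Ginj σ).comp Subtype.val_injective
    simp only [Finset.mem_sigma, Finset.mem_filter, Finset.mem_univ, true_and, Finset.mem_product]
    refine ⟨⟨?_, ?_⟩, ⟨i1, trivial⟩, i2, ?_⟩
    · rw [Finset.card_image_of_injective _ i1, Finset.card_univ, Fintype.card_subtype]
      have : Finset.univ.filter (fun k => k < i) = Finset.Iio i := by ext; simp
      rw [this, Fin.card_Iio]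
    · simp only [Finset.mem_image, Finset.mem_univ, true_and, not_exists]
      rintro ⟨k, hk⟩ h
      exact hk.ne (Ginj σ (h.trans (Gi σ).symm))
    · ext y
      obtain ⟨k, rfl⟩ := Gsurj σ y
      have hj : G σ k = j ↔ k = i := by rw [← Gi σ]; exact (Ginj σ).eq_iff
      simp [(Ginj σ).eq_iff, hj, lt_iff_le_and_ne]
      grind
  · intro σ _ σ' _ h
    simp only [Sigma.mk.injEq, heq_eq_eq, Prod.mk.injEq] at h
    obtain ⟨-, h1, h2⟩ := h
    ext x : 1
    apply Fin.succAbove_right_injective (p := j)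
    rw [← Gs, ← Gs]
    rcases lt_or_gt_of_ne (Fin.succAbove_ne i x) with hl | hl
    · exact congrFun h1 ⟨_, hl⟩
    · exact congrFun h2 ⟨_, hl⟩
  · rintro ⟨S, τ, ρ⟩ h
    simp only [Finset.mem_sigma, Finset.mem_filter, Finset.mem_univ, true_and,
      Finset.mem_product] at h
    obtain ⟨⟨-, hjS⟩, ⟨hτ, hτS⟩, hρ, hρS⟩ := h
    have t1 : ∀ k, τ k ∈ S := fun k => hτS ▸ Finset.mem_image_of_mem _ (Finset.mem_univ _)
    have r1 : ∀ k, ρ k ∉ insert j S := fun k => by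
      rw [← Finset.mem_compl, ← hρS]
      exact Finset.mem_image_of_mem _ (Finset.mem_univ _)
    let g : Fin (n + 1) → Fin (n + 1) := fun k =>
      if h : k < i then τ ⟨k, h⟩ else if h : i < k then ρ ⟨k, h⟩ else j
    have gl : ∀ k (h : k < i), g k = τ ⟨k, h⟩ := fun k h => by simp [g, h]
    have gr : ∀ k (h : i < k), g k = ρ ⟨k, h⟩ := fun k h => by simp [g, h, h.not_gt]
    have gi : g i = j := by simp [g]
    clear_value g
    have ginj : Function.Injective g := by
      intro a b hab
      simp only [Finset.mem_insert, not_or] at r1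
      rcases lt_trichotomy a i with ha | ha | ha <;> rcases lt_trichotomy b i with hb | hb | hb
      · rw [gl a ha, gl b hb] at hab
        simpa using hτ hab
      · rw [gl a ha, hb, gi] at hab
        exact absurd (hab ▸ t1 _) hjS
      · rw [gl a ha, gr b hb] at hab
        exact absurd (hab ▸ t1 _) (r1 _).2
      · rw [ha, gi, gl b hb] at hab
        exact absurd (hab ▸ t1 _) hjS
      · exact ha.trans hb.symm
      · rw [ha, gi, gr b hb] at hab
        exact absurd hab.symm (r1 _).1
      · rw [gr a ha, gl b hb] at hab
        exact absurd (hab ▸ t1 _) (r1 _).2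
      · rw [gr a ha, hb, gi] at hab
        exact absurd hab (r1 _).1
      · rw [gr a ha, gr b hb] at hab
        simpa using hρ hab
    have hne : ∀ x, ∃ y, j.succAbove y = g (i.succAbove x) := fun x =>
      Fin.exists_succAbove_eq (fun h => Fin.succAbove_ne i x (ginj (h.trans gi.symm)))
    choose f hf using hne
    have finj : Function.Injective f := by
      intro a b hab
      have := congrArg j.succAbove hab
      rw [hf, hf] at this
      exact Fin.succAbove_right_injective (ginj this)
    let σ : Equiv.Perm (Fin n) := Equiv.ofBijective f (Finite.injective_iff_bijective.mp finj)
    have hG : G σ = g := by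
      funext k
      rcases Fin.eq_self_or_eq_succAbove i k with rfl | ⟨x, rfl⟩
      · rw [Gi, gi]
      · rw [Gs, ← hf]; rfl
    refine ⟨σ, Finset.mem_univ _, ?_⟩
    have e1 : (fun k : {k // k < i} => G σ k) = τ := by
      funext k; rw [hG]; exact gl _ k.2
    have e2 : (fun k : {k // i < k} => G σ k) = ρ := by
      funext k; rw [hG]; exact gr _ k.2
    rw [e1, e2, hτS]
  · intro σ _
    rw [← aux_prod i (fun k => A k (G σ k))]
    simp [Gs]
end

section
/- For every even integer q ≥ 2, there exists no semi-pandiagonal Latin square of order q; that is, there is no function L : ZMod q × ZMod q → ZMod q such that for every fixed i the map j ↦ L(i,j) is a bijection, for every fixed j the map i ↦ L(i,j) is a bijection, and for every fixed d the map i ↦ L(i, d+i) is a bijection. -/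
/-- A semi-pandiagonal Latin square of order `q`: rows, columns and all broken
right diagonals are permutations of the alphabet. -/
def IsSemiPandiagonalLatinSquare (q : ℕ) (L : ZMod q × ZMod q → ZMod q) : Prop :=
  (∀ i, Function.Bijective fun j => L (i, j)) ∧
  (∀ j, Function.Bijective fun i => L (i, j)) ∧
  (∀ d, Function.Bijective fun i => L (i, d + i))

/-- There is no semi-pandiagonal Latin square of even order `q ≥ 2`. -/
theorem no_semiPandiagonal_of_even (q : ℕ) (hq : 2 ≤ q) (heven : Even q) :
    ¬ ∃ L : ZMod q × ZMod q → ZMod q, IsSemiPandiagonalLatinSquare q L := by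
  rintro ⟨L, hrow, hcol, hdiag⟩
  haveI : NeZero q := ⟨by omega⟩
  choose f hf using fun i => (hrow i).2 0
  have hf1 : Function.Injective f := by
    intro a b hab
    apply (hcol (f a)).1
    have h1 := hf a
    have h2 := hf b
    rw [← hab] at h2
    exact h1.trans h2.symm
  have hf2 : Function.Injective (fun i => f i - i) := by
    intro a b hab
    apply (hdiag (f a - a)).1
    have h1 := hf a
    have h2 := hf b
    have h3 : f a - a + b = f b := by
      have : f a - a = f b - b := hab
      rw [this]; ring
    simp only [h3, sub_add_cancel]
    exact h1.trans h2.symm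
  have e1 : ∑ i, f i = ∑ i : ZMod q, i :=
    (Finite.injective_iff_bijective.1 hf1).sum_comp (fun i => i)
  have e2 : ∑ i, (f i - i) = ∑ i : ZMod q, i :=
    (Finite.injective_iff_bijective.1 hf2).sum_comp (fun i => i)
  rw [Finset.sum_sub_distrib, e1, sub_self] at e2
  have e3 : ∑ i : ZMod q, i = ((∑ i ∈ Finset.range q, i : ℕ) : ZMod q) := by
    push_cast
    symm
    refine Finset.sum_bij' (fun i _ => (i : ZMod q)) (fun x _ => x.val) ?_ ?_ ?_ ?_ ?_
    · simp
    · intro x _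
      simpa using ZMod.val_lt x
    · intro a ha
      exact ZMod.val_cast_of_lt (by simpa using ha)
    · intro x _
      simp
    · simp
  rw [e3] at e2
  obtain ⟨c, hc⟩ := (ZMod.natCast_eq_zero_iff _ _).1 e2.symm
  have h4 := Finset.sum_range_id_mul_two q
  rw [hc] at h4
  have h5 : c * 2 = q - 1 := by
    apply Nat.eq_of_mul_eq_mul_left (show 0 < q by omega)
    rw [← h4]; ring
  obtain ⟨k, hk⟩ := heven
  omega
end

section
/- The number of semi-pandiagonal Latin squares of order 3 is exactly 3! = 6. -/
theorem spl_third (a b c x : ZMod 3) (h1 : a ≠ b) (h2 : a ≠ c) (h3 : b ≠ c) (h4 : x ≠ a)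
    (h5 : x ≠ b) : x = c := by
  have key : ∀ a b c x : Fin 3, ¬ (a ≠ b ∧ a ≠ c ∧ b ≠ c ∧ x ≠ a ∧ x ≠ b) ∨ x = c := by decide
  rcases key a b c x with h | h
  · exact absurd ⟨h1, h2, h3, h4, h5⟩ h
  · exact h

theorem spl_step {L : ZMod 3 × ZMod 3 → ZMod 3} (h : IsSemiPandiagonalLatinSquare 3 L)
    (i k : ZMod 3) : L (i + 1, k) = L (i, k + 1) := by
  obtain ⟨hr, hc, hd⟩ := h
  have e1 : k ≠ k - 1 := by revert k; decide
  have e2 : k ≠ k + 1 := by revert k; decide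
  have e3 : k - 1 ≠ k + 1 := by revert k; decide
  have e4 : i + 1 ≠ i := by revert i; decide
  refine spl_third (L (i, k)) (L (i, k - 1)) _ _ (fun e => e1 ((hr i).1 e))
    (fun e => e2 ((hr i).1 e)) (fun e => e3 ((hr i).1 e)) (fun e => e4 ((hc k).1 e))
    (fun e => e4 ((hd (k - 1 - i)).1 ?_))
  have a1 : k - 1 - i + (i + 1) = k := by ring
  have a2 : k - 1 - i + i = k - 1 := by ring
  simp only [a1, a2]
  exact e

theorem spl_eq {L : ZMod 3 × ZMod 3 → ZMod 3} (h : IsSemiPandiagonalLatinSquare 3 L)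
    (i k : ZMod 3) : L (i, k) = L (0, i + k) := by
  have h0 := spl_step h 0
  have h1 := spl_step h 1
  have hi : i = 0 ∨ i = 0 + 1 ∨ i = 1 + 1 := by revert i; decide
  rcases hi with rfl | rfl | rfl
  · rw [zero_add]
  · rw [h0]; congr 2; ring
  · rw [h1, ← zero_add (1 : ZMod 3), h0]; congr 2; ring

theorem spl_mk (f : ZMod 3 → ZMod 3) (hf : Function.Bijective f) :
    IsSemiPandiagonalLatinSquare 3 (fun p => f (p.1 + p.2)) := by
  refine ⟨fun i => hf.comp ?_, fun j => hf.comp (g := f) (f := fun i => i + j) ?_,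
    fun d => hf.comp (g := f) (f := fun i => i + (d + i)) ?_⟩
  · exact (Equiv.addLeft i).bijective
  · exact (Equiv.addRight j).bijective
  · revert d; decide

theorem count_semiPandiagonal_order_3 :
    Nat.card {L : ZMod 3 × ZMod 3 → ZMod 3 // IsSemiPandiagonalLatinSquare 3 L} = 6 := by
  have e : Equiv.Perm (ZMod 3) ≃
      {L : ZMod 3 × ZMod 3 → ZMod 3 // IsSemiPandiagonalLatinSquare 3 L} := by
    refine Equiv.ofBijective (fun f => ⟨fun p => f (p.1 + p.2), spl_mk f f.bijective⟩) ⟨?_, ?_⟩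
    · intro f g hfg
      ext x
      have := congrFun (congrArg Subtype.val hfg) (0, x)
      simp only [zero_add] at this
      rw [this]
    · rintro ⟨L, hL⟩
      refine ⟨Equiv.ofBijective _ (hL.1 0), ?_⟩
      apply Subtype.ext
      funext ⟨i, j⟩
      exact (spl_eq hL i j).symm
  rw [← Nat.card_congr e, Nat.card_perm, Nat.card_zmod]
  rfl
end

section
/- The number of semi-pandiagonal Latin squares of order 5 is exactly 3 · 5! = 360. -/
set_option synthInstance.maxSize 100000 in
set_option synthInstance.maxHeartbeats 4000000 in
set_option maxRecDepth 100000 in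
set_option maxHeartbeats 4000000 in
theorem sp5_key : ∀ a b : ZMod 5, a ≠ b → a ≠ b - 1 → ∀ c : ZMod 5, a ≠ c → b ≠ c → a ≠ c - 2 →
    b - 1 ≠ c - 2 → ∀ d : ZMod 5, a ≠ d → b ≠ d → c ≠ d → a ≠ d - 3 → b - 1 ≠ d - 3 →
    c - 2 ≠ d - 3 → ∀ e : ZMod 5, a ≠ e → b ≠ e → c ≠ e → d ≠ e → a ≠ e - 4 → b - 1 ≠ e - 4 →
    c - 2 ≠ e - 4 → d - 3 ≠ e - 4 →
    (b - a ≠ 0 ∧ b - a ≠ 1 ∧ c = a + (b - a) * 2 ∧ d = a + (b - a) * 3 ∧ e = a + (b - a) * 4) := by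
  decide

theorem sp5_affine (f : ZMod 5 → ZMod 5) (h1 : Function.Injective f)
    (h2 : Function.Injective fun i => f i - i) :
    ∃ c : ZMod 5, c ≠ 0 ∧ c ≠ 1 ∧ ∀ i, f i = f 0 + c * i := by
  have n1 : ∀ i j : ZMod 5, i ≠ j → f i ≠ f j := fun i j h e => h (h1 e)
  have n2 : ∀ i j : ZMod 5, i ≠ j → f i - i ≠ f j - j := fun i j h e => h (h2 e)
  have n3 : ∀ j : ZMod 5, 0 ≠ j → f 0 ≠ f j - j := fun j h e => n2 0 j h (by simpa using e)
  obtain ⟨k1, k2, k3, k4, k5⟩ := sp5_key (f 0) (f 1) (n1 _ _ (by decide)) (n3 _ (by decide))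
    (f 2) (n1 _ _ (by decide)) (n1 _ _ (by decide)) (n3 _ (by decide)) (n2 _ _ (by decide))
    (f 3) (n1 _ _ (by decide)) (n1 _ _ (by decide)) (n1 _ _ (by decide))
    (n3 _ (by decide)) (n2 _ _ (by decide)) (n2 _ _ (by decide))
    (f 4) (n1 _ _ (by decide)) (n1 _ _ (by decide)) (n1 _ _ (by decide)) (n1 _ _ (by decide))
    (n3 _ (by decide)) (n2 _ _ (by decide)) (n2 _ _ (by decide)) (n2 _ _ (by decide))
  refine ⟨f 1 - f 0, k1, k2, fun i => ?_⟩
  have hi : ∀ i : ZMod 5, i = 0 ∨ i = 1 ∨ i = 2 ∨ i = 3 ∨ i = 4 := by decide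
  rcases hi i with rfl | rfl | rfl | rfl | rfl
  · ring
  · ring
  · exact k3
  · exact k4
  · exact k5

theorem sp5_struct (L : ZMod 5 × ZMod 5 → ZMod 5) (h : IsSemiPandiagonalLatinSquare 5 L) :
    ∃ c : ZMod 5, (c ≠ 0 ∧ c ≠ 1) ∧ ∀ i j, L (i, j) = L (0, j - c * i) := by
  obtain ⟨hr, hc, hd⟩ := h
  choose p hp using fun s i => (hr i).2 s
  have hp' : ∀ s i, L (i, p s i) = s := hp
  have ha : ∀ s, ∃ c : ZMod 5, c ≠ 0 ∧ c ≠ 1 ∧ ∀ i, p s i = p s 0 + c * i := by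
    intro s
    apply sp5_affine
    · intro i j e
      apply (hc (p s i)).1
      show L (i, p s i) = L (j, p s i)
      rw [hp', e, hp']
    · intro i j e
      have e' : p s i - i = p s j - j := e
      apply (hd (p s i - i)).1
      show L (i, p s i - i + i) = L (j, p s i - i + j)
      rw [sub_add_cancel, hp', e', sub_add_cancel, hp']
  choose k hk0 hk1 hk using ha
  have hsolve : ∀ a b c d : ZMod 5, c ≠ d → ∃ i, a + c * i = b + d * i := by decide
  have hconst : ∀ s t, k s = k t := by
    intro s t
    by_contra hne
    obtain ⟨i, hi⟩ := hsolve (p s 0) (p t 0) _ _ hne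
    rw [← hk, ← hk] at hi
    have : s = t := by rw [← hp' s i, hi, hp']
    exact hne (by rw [this])
  refine ⟨k 0, ⟨hk0 0, hk1 0⟩, fun i j => ?_⟩
  have hj : p (L (i, j)) i = j := (hr i).1 (hp' _ i)
  have h0 : p (L (i, j)) 0 = j - k 0 * i := by
    have := hk (L (i, j)) i
    rw [hj, hconst _ 0] at this
    exact eq_sub_of_add_eq this.symm
  rw [← h0, hp']

theorem sp5_mk (c : ZMod 5) (hc : c ≠ 0 ∧ c ≠ 1) (σ : Equiv.Perm (ZMod 5)) :
    IsSemiPandiagonalLatinSquare 5 (fun x => σ (x.2 - c * x.1)) := by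
  have h1 : ∀ c : ZMod 5, c ≠ 0 ∧ c ≠ 1 → ∀ j a b : ZMod 5, j - c * a = j - c * b → a = b := by
    decide
  have h2 : ∀ c : ZMod 5, c ≠ 0 ∧ c ≠ 1 → ∀ j a b : ZMod 5,
      j + a - c * a = j + b - c * b → a = b := by decide
  refine ⟨fun i => Finite.injective_iff_bijective.1 ?_,
    fun i => Finite.injective_iff_bijective.1 ?_, fun i => Finite.injective_iff_bijective.1 ?_⟩
  · intro a b e
    exact sub_left_injective (σ.injective e)
  · intro a b e
    exact h1 c hc _ _ _ (σ.injective e)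
  · intro a b e
    exact h2 c hc _ _ _ (σ.injective e)

/-- The number of semi-pandiagonal Latin squares of order 5 is exactly 3 · 5! = 360. -/
theorem count_semiPandiagonal_order_5 :
    Nat.card {L : ZMod 5 × ZMod 5 → ZMod 5 // IsSemiPandiagonalLatinSquare 5 L} = 360 := by
  let F : {c : ZMod 5 // c ≠ 0 ∧ c ≠ 1} × Equiv.Perm (ZMod 5) →
      {L : ZMod 5 × ZMod 5 → ZMod 5 // IsSemiPandiagonalLatinSquare 5 L} :=
    fun x => ⟨_, sp5_mk x.1.1 x.1.2 x.2⟩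
  have hF : Function.Bijective F := by
    constructor
    · rintro ⟨⟨c, hc⟩, σ⟩ ⟨⟨d, hd⟩, τ⟩ e
      have e' : ∀ i j : ZMod 5, σ (j - c * i) = τ (j - d * i) :=
        fun i j => congrFun (congrArg Subtype.val e) (i, j)
      have hs : σ = τ := by
        ext1 j
        simpa using e' 0 j
      subst hs
      have hcd : c = d := by simpa using e' 1 0
      subst hcd
      rfl
    · rintro ⟨L, hL⟩
      obtain ⟨c, hc, h⟩ := sp5_struct L hL
      refine ⟨⟨⟨c, hc⟩, Equiv.ofBijective _ (hL.1 0)⟩, Subtype.ext ?_⟩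
      funext ⟨i, j⟩
      exact (h i j).symm
  rw [← Nat.card_congr (Equiv.ofBijective F hF), Nat.card_prod, Nat.card_perm, Nat.card_zmod]
  have : Nat.card {c : ZMod 5 // c ≠ 0 ∧ c ≠ 1} = 3 := by
    rw [Nat.card_eq_fintype_card]
    decide
  rw [this]
  rfl
end

section
/- The number of semi-pandiagonal Latin squares of order 7 is exactly 635 · 7! = 3,200,400. -/
namespace SPLS

def enum {α : Type} (R : α → α → Bool) : List (List α) → List (List α)
  | [] => [[]]
  | c :: cs => (enum R cs).flatMap fun l =>
      (c.filter fun a => l.all fun b => R a b).map fun a => a :: l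

theorem mem_enum {α : Type} (R : α → α → Bool) (cs : List (List α)) (l : List α) :
    l ∈ enum R cs ↔ List.Forall₂ (fun a c => a ∈ c) l cs ∧ l.Pairwise (fun a b => R a b = true) := by
  induction cs generalizing l with
  | nil => 
    simp only [enum, List.mem_singleton, List.forall₂_nil_right_iff]
    constructor
    · rintro rfl; simp
    · exact fun h => h.1
  | cons c cs ih =>
    cases l with
    | nil => simp [enum]
    | cons a l =>
      simp only [enum, List.mem_flatMap, List.mem_map, List.mem_filter, List.all_eq_true,
        List.forall₂_cons, List.pairwise_cons]
      constructor
      · rintro ⟨l', hl', a', ⟨h1, h2⟩, h3⟩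
        obtain ⟨rfl, rfl⟩ := List.cons.inj h3
        have := (ih _).1 hl'
        exact ⟨⟨h1, this.1⟩, h2, this.2⟩
      · rintro ⟨⟨h1, h2⟩, h3, h4⟩
        exact ⟨l, (ih _).2 ⟨h2, h4⟩, a, ⟨h1, h3⟩, rfl⟩

theorem nodup_enum {α : Type} (R : α → α → Bool) (cs : List (List α))
    (h : ∀ c ∈ cs, c.Nodup) : (enum R cs).Nodup := by
  induction cs with
  | nil => simp [enum]
  | cons c cs ih =>
    rw [enum, List.nodup_flatMap]
    constructor
    · intro l _
      refine List.Nodup.map (fun a b hab => (List.cons.inj hab).1) ?_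
      exact (h c (by simp)).filter _
    · refine (ih fun c hc => h c (by simp [hc])).imp ?_
      intro l l' hne
      simp only [Function.onFun, List.disjoint_left, List.mem_map]
      rintro _ ⟨a, _, rfl⟩ ⟨b, _, hb⟩
      exact hne (List.cons.inj hb).2.symm

/-- Cell codes: `7 * row + column`. -/
def R1 (m n : ℕ) : Bool :=
  !(Nat.beq (m % 7) (n % 7)) && !(Nat.beq ((m % 7 + 7 - m / 7) % 7) ((n % 7 + 7 - n / 7) % 7))

def c1 (s : ℕ) : List (List ℕ) :=
  [[s], [7,8,9,10,11,12,13], [14,15,16,17,18,19,20], [21,22,23,24,25,26,27],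
   [28,29,30,31,32,33,34], [35,36,37,38,39,40,41], [42,43,44,45,46,47,48]]

def R2 : List ℕ → List ℕ → Bool
  | a :: l, b :: m => !(Nat.beq a b) && R2 l m
  | _, _ => true

def c2 : List (List (List ℕ)) :=
  [enum R1 (c1 0), enum R1 (c1 1), enum R1 (c1 2), enum R1 (c1 3), enum R1 (c1 4),
   enum R1 (c1 5), enum R1 (c1 6)]

set_option maxRecDepth 100000
theorem length_enum : (enum R2 c2).length = 635 := by
  decide +kernel

theorem inj_of_lt {α : Type} {f : Fin 7 → α} (h : ∀ i j, i < j → f i ≠ f j) :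
    Function.Injective f := by
  intro i j hij
  rcases lt_trichotomy i j with h1 | h1 | h1
  · exact absurd hij (h _ _ h1)
  · exact h1
  · exact absurd hij.symm (h _ _ h1)

theorem forall₂_ofFn {α β : Type} (P : α → β → Prop) {n : ℕ} (f : Fin n → α) (g : Fin n → β) :
    List.Forall₂ P (List.ofFn f) (List.ofFn g) ↔ ∀ i, P (f i) (g i) := by
  rw [List.forall₂_iff_get]
  simp only [List.length_ofFn, List.get_eq_getElem, List.getElem_ofFn, true_and]
  exact ⟨fun h i => h i i.2 i.2, fun h i h1 _ => h ⟨i, h1⟩⟩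

theorem c1_eq (s : ℕ) : c1 s = List.ofFn (fun i : Fin 7 =>
    if i = 0 then [s] else List.ofFn (fun a : Fin 7 => 7 * i.val + a.val)) := by
  simp [c1, List.ofFn_succ]

theorem c2_eq : c2 = List.ofFn (fun s : Fin 7 => enum R1 (c1 s.val)) := by
  simp [c2, List.ofFn_succ]

theorem R1_code (i j a b : Fin 7) : R1 (7 * i.val + a.val) (7 * j.val + b.val) = true ↔
    a ≠ b ∧ a - i ≠ b - j := by
  revert i j a b
  decide +kernel

theorem R2_ofFn {n : ℕ} (f g : Fin n → ℕ) :
    R2 (List.ofFn f) (List.ofFn g) = true ↔ ∀ i, f i ≠ g i := by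
  induction n with
  | zero => simp [R2]
  | succ n ih =>
    simp only [List.ofFn_succ, R2, Bool.and_eq_true, ih, Fin.forall_fin_succ]
    refine and_congr ?_ Iff.rfl
    rw [Bool.not_eq_true', ← Bool.not_eq_true, Nat.beq_eq]

theorem c1_nodup (s : ℕ) : ∀ c ∈ c1 s, c.Nodup := by
  simp [c1]

theorem c2_nodup : ∀ c ∈ c2, c.Nodup := by
  rw [c2_eq]
  intro c hc
  obtain ⟨s, rfl⟩ := (List.mem_ofFn' _ _).1 hc
  exact nodup_enum _ _ (c1_nodup _)

theorem exists_ofFn {α β : Type} (P : α → β → Prop) {n : ℕ} (l : List α) (g : Fin n → β)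
    (h : List.Forall₂ P l (List.ofFn g)) : ∃ f : Fin n → α, l = List.ofFn f := by
  have := h.length_eq
  rw [List.length_ofFn] at this
  subst this
  exact ⟨l.get, (List.ofFn_get l).symm⟩

def code (f : Fin 7 → Fin 7) : List ℕ := List.ofFn fun i => 7 * i.val + (f i).val

theorem code_inj : Function.Injective code := by
  intro f g h
  have h := List.ofFn_injective h
  funext i
  have := congrFun h i
  omega

theorem mem_enum1 (s : Fin 7) (l : List ℕ) : l ∈ enum R1 (c1 s.val) ↔
    ∃ f : Fin 7 → Fin 7, l = code f ∧ f 0 = s ∧ Function.Injective f ∧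
      Function.Injective fun i => f i - i := by
  rw [mem_enum, c1_eq]
  constructor
  · rintro ⟨h1, h2⟩
    obtain ⟨p, rfl⟩ := exists_ofFn _ _ _ h1
    rw [forall₂_ofFn] at h1
    have : ∀ i : Fin 7, ∃ a : Fin 7, p i = 7 * i.val + a.val ∧ (i = 0 → a = s) := by
      intro i
      have := h1 i
      by_cases hi : i = 0
      · subst hi
        exact ⟨s, by simpa using this, fun _ => rfl⟩
      · simp only [hi, if_false] at this
        obtain ⟨a, ha⟩ := (List.mem_ofFn' _ _).1 this
        exact ⟨a, ha.symm, fun h => absurd h hi⟩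
    choose f hf hf0 using this
    obtain rfl : p = fun i => 7 * i.val + (f i).val := funext hf
    rw [List.pairwise_ofFn] at h2
    simp only [R1_code] at h2
    refine ⟨f, rfl, hf0 0 rfl, ?_, ?_⟩
    · exact inj_of_lt fun i j hij => (h2 hij).1
    · exact inj_of_lt fun i j hij => (h2 hij).2
  · rintro ⟨f, rfl, h0, h1, h2⟩
    refine ⟨?_, ?_⟩
    · rw [code, forall₂_ofFn]
      intro i
      by_cases hi : i = 0
      · subst hi; simp [h0]
      · simp only [hi, if_false]
        exact (List.mem_ofFn' _ _).2 ⟨f i, rfl⟩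
    · rw [code, List.pairwise_ofFn]
      intro i j hij
      rw [R1_code]
      exact ⟨h1.ne hij.ne, h2.ne hij.ne⟩

theorem R2_code (f g : Fin 7 → Fin 7) : R2 (code f) (code g) = true ↔ ∀ i, f i ≠ g i := by
  rw [code, code, R2_ofFn]
  refine forall_congr' fun i => ?_
  rw [Ne, Ne, Fin.ext_iff]
  omega

/-- `r i v` is the column of the symbol `v` in row `i`. -/
def P (r : Fin 7 → Equiv.Perm (Fin 7)) : Prop :=
  ∀ v, (Function.Injective fun i => r i v) ∧ (Function.Injective fun i => r i v - i)

def toL (r : Fin 7 → Equiv.Perm (Fin 7)) : List (List ℕ) :=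
  List.ofFn fun v => code fun i => r i v

theorem toL_inj : Function.Injective toL := by
  intro r r' h
  have h := List.ofFn_injective h
  funext i
  ext v : 1
  exact congrFun (code_inj (congrFun h v)) i

theorem toL_mem (r : Fin 7 → Equiv.Perm (Fin 7)) (h0 : r 0 = 1) (h : P r) :
    toL r ∈ enum R2 c2 := by
  rw [mem_enum, c2_eq, toL, forall₂_ofFn, List.pairwise_ofFn]
  refine ⟨fun v => (mem_enum1 _ _).2 ⟨_, rfl, by simp [h0], (h v).1, (h v).2⟩, ?_⟩
  intro v w hvw
  rw [R2_code]
  exact fun i => (r i).injective.ne hvw.ne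

theorem toL_surj (l : List (List ℕ)) (hl : l ∈ enum R2 c2) : ∃ r, r 0 = 1 ∧ P r ∧ toL r = l := by
  rw [mem_enum, c2_eq] at hl
  obtain ⟨h1, h2⟩ := hl
  obtain ⟨p, rfl⟩ := exists_ofFn _ _ _ h1
  rw [forall₂_ofFn] at h1
  simp only [mem_enum1] at h1
  choose f hf h0 hi hd using h1
  obtain rfl : p = fun v => code (f v) := funext hf
  rw [List.pairwise_ofFn] at h2
  simp only [R2_code] at h2
  have hb : ∀ i, Function.Bijective fun v => f v i := fun i =>
    Finite.injective_iff_bijective.1 (inj_of_lt fun v w hvw => h2 hvw i)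
  refine ⟨fun i => Equiv.ofBijective _ (hb i), ?_, fun v => ⟨hi v, hd v⟩, rfl⟩
  ext v : 1
  exact h0 v

theorem card_norm : Nat.card {r : Fin 7 → Equiv.Perm (Fin 7) // r 0 = 1 ∧ P r} = 635 := by
  have e : {r : Fin 7 → Equiv.Perm (Fin 7) // r 0 = 1 ∧ P r} ≃ (enum R2 c2).toFinset :=
    Equiv.ofBijective (fun r => ⟨toL r.1, List.mem_toFinset.2 (toL_mem r.1 r.2.1 r.2.2)⟩) <| by
      constructor
      · intro r r' h
        exact Subtype.ext (toL_inj (congrArg Subtype.val h))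
      · rintro ⟨l, hl⟩
        obtain ⟨r, h0, h, rfl⟩ := toL_surj l (List.mem_toFinset.1 hl)
        exact ⟨⟨r, h0, h⟩, rfl⟩
  rw [Nat.card_congr e, Nat.card_eq_fintype_card, Fintype.card_coe,
    List.toFinset_card_of_nodup (nodup_enum _ _ c2_nodup), length_enum]

theorem P_mul (r : Fin 7 → Equiv.Perm (Fin 7)) (σ : Equiv.Perm (Fin 7)) (h : P r) :
    P fun i => r i * σ := fun v => h (σ v)

def e2 : {r : Fin 7 → Equiv.Perm (Fin 7) // P r} ≃
    Equiv.Perm (Fin 7) × {r : Fin 7 → Equiv.Perm (Fin 7) // r 0 = 1 ∧ P r} where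
  toFun r := (r.1 0, ⟨fun i => r.1 i * (r.1 0)⁻¹, by simp, P_mul _ _ r.2⟩)
  invFun x := ⟨fun i => x.2.1 i * x.1, P_mul _ _ x.2.2.2⟩
  left_inv r := by ext; simp
  right_inv x := by
    obtain ⟨σ, r, h0, h⟩ := x
    simp [h0]

theorem P_iff (r : Fin 7 → Equiv.Perm (Fin 7)) : P r ↔
    (∀ j, Function.Injective fun i => (r i).symm j) ∧
    (∀ d, Function.Injective fun i => (r i).symm (d + i)) := by
  constructor
  · intro h
    constructor
    · intro j i i' hii
      simp only at hii
      refine (h ((r i).symm j)).1 ?_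
      simp only [Equiv.apply_symm_apply]
      rw [hii, Equiv.apply_symm_apply]
    · intro d i i' hii
      simp only at hii
      refine (h ((r i).symm (d + i))).2 ?_
      simp only [Equiv.apply_symm_apply]
      rw [hii, Equiv.apply_symm_apply]
      simp
  · rintro ⟨h1, h2⟩ v
    constructor
    · intro i i' hii
      simp only at hii
      refine h1 (r i v) ?_
      simp only [Equiv.symm_apply_apply]
      rw [hii, Equiv.symm_apply_apply]
    · intro i i' hii
      simp only at hii
      refine h2 (r i v - i) ?_
      simp only
      rw [sub_add_cancel, hii, sub_add_cancel]
      simp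

theorem card_S : Nat.card {L : ZMod 7 × ZMod 7 → ZMod 7 // IsSemiPandiagonalLatinSquare 7 L} =
    Nat.card {r : Fin 7 → Equiv.Perm (Fin 7) // P r} := by
  symm
  refine Nat.card_congr (Equiv.ofBijective
    (fun r => ⟨fun x => (r.1 x.1).symm x.2, fun i => (r.1 i).symm.bijective, ?_, ?_⟩) ⟨?_, ?_⟩)
  · exact fun j => Finite.injective_iff_bijective.1 (((P_iff _).1 r.2).1 j)
  · exact fun d => Finite.injective_iff_bijective.1 (((P_iff _).1 r.2).2 d)
  · intro r r' h
    have h := congrArg Subtype.val h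
    refine Subtype.ext (funext fun i => Equiv.symm_bijective.injective (Equiv.ext fun j => ?_))
    exact congrFun h (i, j)
  · rintro ⟨L, h1, h2, h3⟩
    refine ⟨⟨fun i => (Equiv.ofBijective _ (h1 i)).symm, (P_iff _).2 ⟨?_, ?_⟩⟩, ?_⟩
    · exact fun j => (h2 j).1
    · exact fun d => (h3 d).1
    · rfl

end SPLS

/-- The number of semi-pandiagonal Latin squares of order 7 is exactly 635 · 7! = 3,200,400. -/
theorem count_semiPandiagonal_order_7 :
    Nat.card {L : ZMod 7 × ZMod 7 → ZMod 7 // IsSemiPandiagonalLatinSquare 7 L} = 3200400 := by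
  rw [SPLS.card_S, Nat.card_congr SPLS.e2, Nat.card_prod, SPLS.card_norm, Nat.card_perm]
  simp [Nat.factorial]
end
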